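/- arXiv:math/0602122 — 2 statements merged into one kernel-verified Lean document; each statement's English description precedes it below -/
import Mathlib

section
/- Let E : B → A have finite index and C*⟨B, e_A⟩ be the basic construction. Then for each x ∈ C*⟨B, e_A⟩ there exists a unique b ∈ B with e_A x = e_A b. -/
/- Watatani-style conditional expectations, quasi-bases, and the C*-basic
construction, formalized abstractly. -/

noncomputable section

/-- A conditional expectation of a unital C*-algebra `B` onto a C*-subalgebra `A`. -/
structure CondExp (B : Type*) [NormedRing B] [StarRing B] [NormedAlgebra ℂ B] [StarModule ℂ B]
    (A : StarSubalgebra ℂ B) where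
  toFun : B →ₗ[ℂ] B
  mem_range : ∀ b, toFun b ∈ A
  fixes : ∀ a ∈ A, toFun a = a
  left_mod : ∀ a ∈ A, ∀ b, toFun (a * b) = a * toFun b
  right_mod : ∀ a ∈ A, ∀ b, toFun (b * a) = toFun b * a
  star_map : ∀ b, toFun (star b) = star (toFun b)
  pos : ∀ b, ∃ c, toFun (star b * b) = star c * c

/-- `x` is a quasi-basis for the conditional expectation `E` (with pairs `(x i, (x i)*)`). -/
def IsQuasiBasis {B : Type*} [NormedRing B] [StarRing B] [NormedAlgebra ℂ B] [StarModule ℂ B]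
    {A : StarSubalgebra ℂ B} (E : CondExp B A) {n : ℕ} (x : Fin n → B) : Prop :=
  (∀ b, ∑ i, x i * E.toFun (star (x i) * b) = b) ∧
  (∀ b, ∑ i, E.toFun (b * x i) * star (x i) = b)

/-- The C*-basic construction `C = C*⟨B, e_A⟩` of a conditional expectation `E : B → A`,
with Jones projection `e`. -/
structure BasicConstruction {B : Type*} [NormedRing B] [StarRing B] [NormedAlgebra ℂ B] [StarModule ℂ B]
    {A : StarSubalgebra ℂ B} (E : CondExp B A)
    (C : Type*) [NormedRing C] [StarRing C] [NormedAlgebra ℂ C] [StarModule ℂ C] where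
  ι : B →⋆ₐ[ℂ] C
  inj : Function.Injective ι
  e : C
  e_star : star e = e
  e_idem : e * e = e
  jones : ∀ b, e * ι b * e = ι (E.toFun b) * e
  dense : (Submodule.span ℂ {y : C | ∃ b c : B, y = ι b * e * ι c}).topologicalClosure = ⊤
  mul_e_inj : ∀ b : B, ι b * e = 0 → b = 0

namespace BasicConstruction

section Algebra

variable {B C : Type*} [NormedRing B] [StarRing B] [NormedAlgebra ℂ B] [StarModule ℂ B]
  [NormedRing C] [StarRing C] [NormedAlgebra ℂ C] [StarModule ℂ C]
  {A : StarSubalgebra ℂ B} {E : CondExp B A} (bc : BasicConstruction E C)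

/-- The Jones projection commutes with `A`. -/
theorem e_mul_ι {a : B} (ha : a ∈ A) : bc.e * bc.ι a = bc.ι a * bc.e := by
  have h := congrArg star (bc.jones (star a))
  rw [E.fixes _ (star_mem ha)] at h
  simp only [star_mul, bc.e_star, map_star, star_star] at h
  rw [← h, ← mul_assoc, bc.jones, E.fixes a ha]

/-- An element of `B` lies in `A` if and only if it commutes with the Jones projection. -/
theorem mem_iff_commute {a : B} : a ∈ A ↔ bc.e * bc.ι a = bc.ι a * bc.e := by
  refine ⟨bc.e_mul_ι, fun h => ?_⟩
  have hj := bc.jones a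
  rw [h, mul_assoc, bc.e_idem] at hj
  have : a - E.toFun a = 0 := bc.mul_e_inj _ (by rw [map_sub, sub_mul, hj, sub_self])
  rw [sub_eq_zero.mp this]
  exact E.mem_range a

theorem e_mul_ι_injective {b c : B} (h : bc.e * bc.ι b = bc.e * bc.ι c) : b = c := by
  have h' : bc.ι (star (b - c)) * bc.e = 0 := by
    have := congrArg star (sub_eq_zero.mpr h)
    simpa [← mul_sub, ← map_sub, star_mul, bc.e_star, ← map_star] using this
  exact sub_eq_zero.mp (star_eq_zero.mp (bc.mul_e_inj _ h'))

/-- A property that is closed and linear holds on `C` once it holds on each `b e c`. -/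
theorem closed_submodule_eq_top (p : Submodule ℂ C) (hp : IsClosed (p : Set C))
    (h : ∀ b c, bc.ι b * bc.e * bc.ι c ∈ p) : p = ⊤ := by
  rw [eq_top_iff, ← bc.dense]
  refine Submodule.topologicalClosure_minimal _ (Submodule.span_le.mpr ?_) hp
  rintro _ ⟨b, c, rfl⟩
  exact h b c

/-- A quasi-basis gives a decomposition of the unit of the basic construction. -/
theorem sum_quasiBasis_eq_one {n : ℕ} {x : Fin n → B} (hx : IsQuasiBasis E x) :
    ∑ i, bc.ι (x i) * bc.e * bc.ι (star (x i)) = 1 := by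
  set f := ∑ i, bc.ι (x i) * bc.e * bc.ι (star (x i)) with hf
  have htop := bc.closed_submodule_eq_top
    (LinearMap.eqLocus (LinearMap.mulLeft ℂ f) LinearMap.id)
    (isClosed_eq (continuous_const.mul continuous_id) continuous_id) fun b c => by
      have key : f * (bc.ι b * bc.e) = bc.ι b * bc.e := by
        conv_rhs => rw [← hx.1 b]
        rw [hf, Finset.sum_mul, map_sum, Finset.sum_mul]
        refine Finset.sum_congr rfl fun i _ => ?_
        have hj := bc.jones (star (x i) * b)
        rw [map_mul] at hj
        rw [map_mul, mul_assoc (bc.ι (x i)) _ bc.e, ← hj]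
        simp only [mul_assoc]
      change f * (bc.ι b * bc.e * bc.ι c) = bc.ι b * bc.e * bc.ι c
      rw [← mul_assoc, key]
  have h1 : (1 : C) ∈ LinearMap.eqLocus (LinearMap.mulLeft ℂ f) LinearMap.id := by
    rw [htop]; trivial
  simpa using h1

/-- The representation `a ↦ a e` of `A` on the corner of the Jones projection. -/
def cornerHom : A →⋆ₙₐ[ℂ] C where
  toFun a := bc.ι a * bc.e
  map_smul' r a := by simp
  map_zero' := by simp
  map_add' a b := by simp [add_mul]
  map_mul' a b := by
    rw [mul_assoc, ← mul_assoc bc.e, bc.e_mul_ι b.2, mul_assoc _ bc.e, bc.e_idem]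
    simp [mul_assoc]
  map_star' a := by
    rw [star_mul, bc.e_star, ← map_star, bc.e_mul_ι (star_mem a.2)]
    simp

theorem cornerHom_injective : Function.Injective bc.cornerHom := by
  refine (injective_iff_map_eq_zero bc.cornerHom).mpr fun a ha => ?_
  exact Subtype.ext (bc.mul_e_inj a ha)

end Algebra

section CStar

variable {B C : Type*} [CStarAlgebra B] [CStarAlgebra C]
  {A : StarSubalgebra ℂ B} {E : CondExp B A} (bc : BasicConstruction E C)

theorem isClosed_subalgebra (bc : BasicConstruction E C) : IsClosed (A : Set B) := by
  have hι : Continuous bc.ι := (NonUnitalStarAlgHom.isometry bc.ι bc.inj).continuous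
  have : (A : Set B) = {a | bc.e * bc.ι a = bc.ι a * bc.e} :=
    Set.ext fun a => bc.mem_iff_commute
  rw [this]
  exact isClosed_eq (continuous_const.mul hι) (hι.mul continuous_const)

theorem isClosed_range_cornerHom : IsClosed (Set.range bc.cornerHom) := by
  have : IsClosed (A : Set B) := bc.isClosed_subalgebra
  have hiso : Isometry bc.cornerHom :=
    NonUnitalStarAlgHom.isometry bc.cornerHom bc.cornerHom_injective
  have : CompleteSpace A := IsClosed.completeSpace_coe (s := (A : Set B))
  exact hiso.isClosedEmbedding.isClosed_range

/-- The corner `e C e` equals `A e`. -/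
theorem exists_mem_corner (y : C) : ∃ a ∈ A, bc.e * y * bc.e = bc.ι a * bc.e := by
  let T : C →ₗ[ℂ] C := LinearMap.mulRight ℂ bc.e ∘ₗ LinearMap.mulLeft ℂ bc.e
  let p : Submodule ℂ C := (LinearMap.range (bc.cornerHom : A →ₗ[ℂ] C)).comap T
  have hp : IsClosed (p : Set C) :=
    bc.isClosed_range_cornerHom.preimage
      ((continuous_const.mul continuous_id).mul continuous_const)
  have htop := bc.closed_submodule_eq_top p hp fun b c => by
    refine ⟨⟨E.toFun b * E.toFun c, mul_mem (E.mem_range b) (E.mem_range c)⟩, ?_⟩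
    change bc.ι (E.toFun b * E.toFun c) * bc.e
      = bc.e * (bc.ι b * bc.e * bc.ι c) * bc.e
    calc bc.ι (E.toFun b * E.toFun c) * bc.e
        = bc.ι (E.toFun b) * (bc.ι (E.toFun c) * bc.e) := by rw [map_mul, mul_assoc]
      _ = bc.ι (E.toFun b) * bc.e * bc.ι c * bc.e := by
        rw [← bc.jones c]; simp only [mul_assoc]
      _ = bc.e * (bc.ι b * bc.e * bc.ι c) * bc.e := by
        rw [← bc.jones b]; simp only [mul_assoc]
  have hy : y ∈ p := by rw [htop]; trivial
  obtain ⟨a, ha⟩ := hy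
  exact ⟨a, a.2, ha.symm⟩

theorem exists_e_mul_eq {n : ℕ} {x : Fin n → B} (hx : IsQuasiBasis E x) (y : C) :
    ∃ b, bc.e * y = bc.e * bc.ι b := by
  choose a ha hae using fun i => bc.exists_mem_corner (y * bc.ι (x i))
  refine ⟨∑ i, a i * star (x i), ?_⟩
  calc bc.e * y
      = bc.e * y * ∑ i, bc.ι (x i) * bc.e * bc.ι (star (x i)) := by
        rw [bc.sum_quasiBasis_eq_one hx, mul_one]
    _ = ∑ i, bc.e * (y * bc.ι (x i)) * bc.e * bc.ι (star (x i)) := by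
        simp only [Finset.mul_sum, mul_assoc]
    _ = bc.e * bc.ι (∑ i, a i * star (x i)) := by
        rw [map_sum, Finset.mul_sum]
        refine Finset.sum_congr rfl fun i _ => ?_
        rw [hae, ← bc.e_mul_ι (ha i), map_mul, mul_assoc]

end CStar

end BasicConstruction

/-- for each `x ∈ C*⟨B,e_A⟩` there is a unique `b ∈ B` with
`e_A x = e_A b`. -/
theorem exists_unique_compress
    {B C : Type*} [NormedRing B] [StarRing B] [CStarRing B] [NormedAlgebra ℂ B]
    [StarModule ℂ B] [CompleteSpace B]
    [NormedRing C] [StarRing C] [CStarRing C] [NormedAlgebra ℂ C]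
    [StarModule ℂ C] [CompleteSpace C]
    {A : StarSubalgebra ℂ B} (E : CondExp B A)
    {n : ℕ} (x : Fin n → B) (hx : IsQuasiBasis E x)
    (hidx : ∑ i, x i * star (x i) = (2 : B))
    (bc : BasicConstruction E C)
    (Et : C →ₗ[ℂ] B)
    (hEt : ∀ b c : B, Et (bc.ι b * bc.e * bc.ι c) = ((2 : ℂ))⁻¹ • (b * c))
    :
    ∀ y : C, ∃! b : B, bc.e * y = bc.e * bc.ι b := by
  let : CStarAlgebra B := {}
  let : CStarAlgebra C := {}
  intro y
  obtain ⟨b, hb⟩ := bc.exists_e_mul_eq hx y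
  exact ⟨b, hb, fun c hc => bc.e_mul_ι_injective (hc.symm.trans hb)⟩

end
end

section
/- Let ℒ be the set of pairs (B,E) of unital C*-algebras B ⊇ A with conditional expectation E : B → A of index 2, modulo isomorphisms fixing A and intertwining the expectations, and let ℳ be the set of involutive A-A-equivalence bimodules modulo involutive bimodule isomorphisms. Then the maps [B,E] ↦ [X_B] and [X] ↦ [B_X, E_X] are mutually inverse bijections between ℒ/∼ and ℳ/∼. -/
noncomputable section

universe u

variable (A : Type u) [NormedRing A] [StarRing A] [CStarRing A] [NormedAlgebra ℂ A]
  [StarModule ℂ A] [CompleteSpace A]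

/-- An element of `ℒ`: a unital C*-algebra `B ⊇ A` (given by a unital embedding `ι`)
together with a conditional expectation `E : B → A` of Watatani index 2. -/
structure IncPair where
  B : Type u
  [ring : NormedRing B]
  [str : StarRing B]
  [cstr : CStarRing B]
  [alg : NormedAlgebra ℂ B]
  [smod : StarModule ℂ B]
  [cpl : CompleteSpace B]
  ι : A →⋆ₐ[ℂ] B
  inj : Function.Injective ι
  E : B →ₗ[ℂ] B
  mem : ∀ b, E b ∈ Set.range ι
  fixes : ∀ a, E (ι a) = ι a
  bimod_l : ∀ a b, E (ι a * b) = ι a * E b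
  bimod_r : ∀ a b, E (b * ι a) = E b * ι a
  star_map : ∀ b, E (star b) = star (E b)
  pos : ∀ b, ∃ c, E (star b * b) = star c * c
  index_two : ∃ n, ∃ x : Fin n → B,
    (∀ b, ∑ i, x i * E (star (x i) * b) = b) ∧
    (∀ b, ∑ i, E (b * x i) * star (x i) = b) ∧
    (∑ i, x i * star (x i)) = 2

attribute [instance] IncPair.ring IncPair.str IncPair.cstr IncPair.alg IncPair.smod
  IncPair.cpl

/-- An element of `ℳ`: an involutive A-A-equivalence bimodule. -/
structure InvBimodP where
  X : Type u
  [grp : NormedAddCommGroup X]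
  [mod : NormedSpace ℂ X]
  [cplX : CompleteSpace X]
  ls : A → X →ₗ[ℂ] X
  rs : A → X →ₗ[ℂ] X
  ls_one : ∀ x, ls 1 x = x
  ls_mul : ∀ a b x, ls (a * b) x = ls a (ls b x)
  ls_add : ∀ a b x, ls (a + b) x = ls a x + ls b x
  rs_one : ∀ x, rs 1 x = x
  rs_mul : ∀ a b x, rs (a * b) x = rs b (rs a x)
  rs_add : ∀ a b x, rs (a + b) x = rs a x + rs b x
  ls_rs : ∀ a b x, ls a (rs b x) = rs b (ls a x)
  linn : X → X → A
  rinn : X → X → A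
  linn_add_left : ∀ x y z, linn (x + y) z = linn x z + linn y z
  linn_smul_left : ∀ (c : ℂ) x y, linn (c • x) y = c • linn x y
  linn_star : ∀ x y, star (linn x y) = linn y x
  linn_ls : ∀ a x y, linn (ls a x) y = a * linn x y
  rinn_add_right : ∀ x y z, rinn x (y + z) = rinn x y + rinn x z
  rinn_smul_right : ∀ (c : ℂ) x y, rinn x (c • y) = c • rinn x y
  rinn_star : ∀ x y, star (rinn x y) = rinn y x
  rinn_rs : ∀ a x y, rinn x (rs a y) = rinn x y * a
  compat : ∀ x y z, ls (linn x y) z = rs (rinn y z) x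
  lpos : ∀ x, ∃ a, linn x x = star a * a
  rpos : ∀ x, ∃ a, rinn x x = star a * a
  lfull : (Submodule.span ℂ {a : A | ∃ x y, a = linn x y}).topologicalClosure = ⊤
  rfull : (Submodule.span ℂ {a : A | ∃ x y, a = rinn x y}).topologicalClosure = ⊤
  norm_inn : ∀ x, ‖x‖ ^ 2 = ‖rinn x x‖
  sh : X → X
  sh_add : ∀ x y, sh (x + y) = sh x + sh y
  sh_smul : ∀ (c : ℂ) x, sh (c • x) = star c • sh x
  sh_sh : ∀ x, sh (sh x) = x
  sh_ls : ∀ a x, sh (ls a x) = rs (star a) (sh x)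
  sh_rs : ∀ a x, sh (rs a x) = ls (star a) (sh x)
  sh_inn : ∀ x y, linn x (sh y) = rinn (sh x) y

attribute [instance] InvBimodP.grp InvBimodP.mod InvBimodP.cplX

variable {A}

/-- The equivalence relation on `ℒ`: an isomorphism over `A` intertwining
the conditional expectations. -/
def IncEquiv (P Q : IncPair A) : Prop :=
  ∃ π : P.B ≃⋆ₐ[ℂ] Q.B, (∀ a, π (P.ι a) = Q.ι a) ∧ ∀ b, π (P.E b) = Q.E (π b)

/-- The equivalence relation on `ℳ`: an involutive A-A-equivalence bimodule
isomorphism. -/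
def BimodEquiv (M N : InvBimodP A) : Prop :=
  ∃ ρ : M.X ≃ₗ[ℂ] N.X,
    (∀ a x, ρ (M.ls a x) = N.ls a (ρ x)) ∧
    (∀ a x, ρ (M.rs a x) = N.rs a (ρ x)) ∧
    (∀ x y, N.linn (ρ x) (ρ y) = M.linn x y) ∧
    (∀ x y, N.rinn (ρ x) (ρ y) = M.rinn x y) ∧
    (∀ x, ρ (M.sh x) = N.sh (ρ x))

/-- `M` realizes the involutive bimodule associated to the inclusion `P`, i.e. `M` is
isomorphic (as an involutive bimodule) to
`B₋ = {b : E b = 0} ( ≅ X_B = e_A C*⟨B,e_A⟩(1−e_A) )`, with inner products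
`_A⟨x,y⟩ = E(xy*)`, `⟨x,y⟩_A = E(x*y)` and involution `x^♯ = x*`. -/
def Realizes (P : IncPair A) (M : InvBimodP A) : Prop :=
  ∃ θ : M.X →ₗ[ℂ] P.B,
    Function.Injective θ ∧
    Set.range θ = {b : P.B | P.E b = 0} ∧
    (∀ a x, θ (M.ls a x) = P.ι a * θ x) ∧
    (∀ a x, θ (M.rs a x) = θ x * P.ι a) ∧
    (∀ x y, P.ι (M.linn x y) = P.E (θ x * star (θ y))) ∧
    (∀ x y, P.ι (M.rinn x y) = P.E (star (θ x) * θ y)) ∧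
    (∀ x, θ (M.sh x) = star (θ x))

namespace IncPair

section

variable {D : Type u} [CStarAlgebra D] (P : IncPair D)

instance instCStarAlgebraB : CStarAlgebra P.B where

attribute [local instance] CStarAlgebra.spectralOrder CStarAlgebra.spectralOrderedRing

lemma E_mul_E (x y : P.B) : P.E (x * P.E y) = P.E x * P.E y := by
  obtain ⟨a, ha⟩ := P.mem y
  rw [← ha, P.bimod_r]

lemma E_E_mul (x y : P.B) : P.E (P.E x * y) = P.E x * P.E y := by
  obtain ⟨a, ha⟩ := P.mem x
  rw [← ha, P.bimod_l]

lemma E_E (x : P.B) : P.E (P.E x) = P.E x := by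
  obtain ⟨a, ha⟩ := P.mem x
  rw [← ha, P.fixes]

lemma E_one : P.E 1 = 1 := by
  simpa using P.fixes 1

lemma E_nonneg (x : P.B) : 0 ≤ P.E (star x * x) := by
  obtain ⟨c, hc⟩ := P.pos x
  rw [hc]
  exact star_mul_self_nonneg c

lemma E_star_mul_eq_zero {w : P.B} (hw : P.E (star w * w) = 0) (y : P.B) :
    P.E (star w * y) = 0 := by
  set d := P.E (star w * y) with hd
  have hd' : P.E (star y * w) = star d := by
    rw [hd, ← P.star_map]; simp
  have key (t : ℝ) : (2 * t) • (star d * d) ≤ P.E (star y * y) := by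
    have h := P.E_nonneg (y - (t : ℂ) • (w * d))
    have e1 : P.E (star y * (w * d)) = star d * d := by
      rw [← mul_assoc, hd, P.E_mul_E, ← hd, hd']
    have e2 : P.E (star (w * d) * y) = star d * d := by
      rw [star_mul, mul_assoc, hd, ← P.star_map, P.E_E_mul]
    have e3 : P.E (star (w * d) * (w * d)) = 0 := by
      rw [star_mul, mul_assoc, ← mul_assoc (star w), hd, ← P.star_map, P.E_E_mul,
        P.E_mul_E, hw]
      simp
    have e4 : P.E (star (y - (t : ℂ) • (w * d)) * (y - (t : ℂ) • (w * d)))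
        = P.E (star y * y) - (2 * t) • (star d * d) := by
      simp only [star_sub, star_smul, sub_mul, mul_sub, map_sub, smul_mul_assoc,
        mul_smul_comm, map_smul, e1, e2, e3]
      simp only [RCLike.star_def, Complex.conj_ofReal, Complex.coe_smul]
      module
    rw [e4] at h
    exact sub_nonneg.mp h
  by_contra hne
  have hpos : 0 < ‖d‖ ^ 2 := by
    have := norm_pos_iff.mpr hne
    positivity
  have hn (t : ℝ) (ht : 0 ≤ t) : 2 * t * ‖d‖ ^ 2 ≤ ‖P.E (star y * y)‖ := by
    have h := CStarAlgebra.norm_le_norm_of_nonneg_of_le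
      (smul_nonneg (by positivity) (star_mul_self_nonneg d)) (key t)
    rw [norm_smul, CStarRing.norm_star_mul_self, Real.norm_of_nonneg (by positivity)] at h
    rwa [pow_two]
  have h := hn ((‖P.E (star y * y)‖ + 1) / ‖d‖ ^ 2) (by positivity)
  rw [mul_assoc, div_mul_cancel₀ _ hpos.ne'] at h
  have := norm_nonneg (P.E (star y * y))
  linarith

lemma eq_zero_of_E_star_mul_self {w : P.B} (hw : P.E (star w * w) = 0) : w = 0 := by
  obtain ⟨n, x, -, h, -⟩ := P.index_two
  rw [← star_eq_zero, ← h (star w)]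
  simp [P.E_star_mul_eq_zero hw]

/-- Projecting a quasi-basis to the kernel of the expectation. -/
lemma exists_basis_ker : ∃ n, ∃ v : Fin n → P.B, (∀ i, P.E (v i) = 0) ∧
    (∀ b, P.E b = 0 → ∑ i, v i * P.E (star (v i) * b) = b) ∧ ∑ i, v i * star (v i) = 1 := by
  obtain ⟨n, u, h, -, h2⟩ := P.index_two
  refine ⟨n, fun i => u i - P.E (u i), fun i => by simp [P.E_E], fun b hb => ?_, ?_⟩
  · have e (i) : P.E (star (u i - P.E (u i)) * b) = P.E (star (u i) * b) := by
      rw [star_sub, sub_mul, map_sub, ← P.star_map (u i), P.E_E_mul, hb]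
      simp
    have h' := congrArg P.E (h b)
    simp only [map_sum, P.E_mul_E, hb] at h'
    simp only [e, sub_mul, Finset.sum_sub_distrib, h b, h', sub_zero]
  · have h1 := h 1
    have h1' := congrArg P.E h1
    simp only [map_sum, P.E_mul_E, P.E_one] at h1'
    simp only [mul_one, P.star_map] at h1 h1'
    have h1s := congrArg star h1
    simp only [star_sum, star_mul, star_star, star_one] at h1s
    simp only [star_sub, mul_sub, sub_mul, Finset.sum_sub_distrib, h2, h1, h1', h1s]
    norm_num

/-- For an expectation of index two the product of two elements of its kernel lies in the
base algebra. -/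
lemma E_mul_of_ker {x y : P.B} (hx : P.E x = 0) (hy : P.E y = 0) : P.E (x * y) = x * y := by
  obtain ⟨n, v, hv, hb, h1⟩ := P.exists_basis_ker
  have key (i) {y : P.B} (hy : P.E y = 0) : P.E (star (v i) * y) = star (v i) * y := by
    let w (j) : P.B := star (v j) * y - P.E (star (v j) * y)
    have hw (j) : P.E (w j) = 0 := by simp [w, P.E_E]
    have hsum : ∑ j, v j * w j = 0 := by
      simp only [w, mul_sub, Finset.sum_sub_distrib, hb y hy, ← mul_assoc, ← Finset.sum_mul, h1]
      simp
    have hww (j) : P.E (star (w j) * w j) = P.E (star y * (v j * w j)) := by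
      have : star (w j) = star y * v j - P.E (star y * v j) := by
        simp [w, ← P.star_map]
      rw [this, sub_mul, map_sub, P.E_E_mul, hw, mul_zero, sub_zero, mul_assoc]
    have h0 : ∑ j, P.E (star (w j) * w j) = 0 := by
      simp only [hww, ← map_sum, ← Finset.mul_sum, hsum]
      simp
    have := (Finset.sum_eq_zero_iff_of_nonneg fun j _ => P.E_nonneg (w j)).mp h0 i
      (Finset.mem_univ i)
    exact (sub_eq_zero.mp (P.eq_zero_of_E_star_mul_self this)).symm
  have hx' : P.E (star x) = 0 := by rw [P.star_map, hx, star_zero]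
  have hxs : x = ∑ i, P.E (x * v i) * star (v i) := by
    have := congrArg star (hb _ hx')
    simpa [← P.star_map] using this.symm
  rw [hxs, Finset.sum_mul, map_sum]
  refine Finset.sum_congr rfl fun i _ => ?_
  rw [mul_assoc, P.E_E_mul, key i hy]

lemma norm_E_le (b : P.B) : ‖P.E b‖ ≤ ‖b‖ := by
  have h1 : star (P.E b) * P.E b ≤ P.E (star b * b) := by
    have h := P.E_nonneg (b - P.E b)
    have e : P.E (star (b - P.E b) * (b - P.E b)) = P.E (star b * b) - star (P.E b) * P.E b := by
      simp only [star_sub, sub_mul, mul_sub, map_sub, ← P.star_map, P.E_mul_E, P.E_E_mul, P.E_E]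
      abel
    rw [e] at h
    exact sub_nonneg.mp h
  have h2 : P.E (star b * b) ≤ algebraMap ℝ P.B (‖b‖ ^ 2) := by
    obtain ⟨c, hc⟩ := CStarAlgebra.nonneg_iff_eq_star_mul_self.mp
      (sub_nonneg.mpr (CStarAlgebra.star_mul_le_algebraMap_norm_sq (a := b)))
    have h := P.E_nonneg c
    have e : P.E (algebraMap ℝ P.B (‖b‖ ^ 2)) = algebraMap ℝ P.B (‖b‖ ^ 2) := by
      rw [Algebra.algebraMap_eq_smul_one, ← Complex.coe_smul, map_smul, P.E_one]
    rw [← hc, map_sub, e] at h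
    exact sub_nonneg.mp h
  have h3 := (CStarAlgebra.norm_le_iff_le_algebraMap _ (sq_nonneg ‖b‖)
    (star_mul_self_nonneg (P.E b))).mpr (h1.trans h2)
  rw [CStarRing.norm_star_mul_self, ← pow_two] at h3
  exact (sq_le_sq₀ (norm_nonneg _) (norm_nonneg _)).mp h3

lemma isClosed_ker : IsClosed (LinearMap.ker P.E : Set P.B) :=
  (P.E.mkContinuous 1 fun b => by simpa using P.norm_E_le b).isClosed_ker

/-- The element of the base algebra given by the conditional expectation. -/
def toBase (b : P.B) : D := (P.mem b).choose

@[simp]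
lemma ι_toBase (b : P.B) : P.ι (P.toBase b) = P.E b := (P.mem b).choose_spec

lemma exists_toBase_eq {b : P.B} (hb : 0 ≤ P.E b) : ∃ a, P.toBase b = star a * a := by
  rw [← CStarAlgebra.nonneg_iff_eq_star_mul_self]
  have hsa : IsSelfAdjoint (P.toBase b) := by
    apply P.inj
    rw [map_star, ι_toBase]
    exact (IsSelfAdjoint.of_nonneg hb).star_eq
  rw [StarOrderedRing.nonneg_iff_spectrum_nonneg (R := ℝ) _ hsa,
    ← hsa.map_spectrum_real P.ι P.inj, ι_toBase]
  exact fun x hx => spectrum_nonneg_of_nonneg hb hx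

lemma topologicalClosure_span_eq_top {S : Set D} (h : (1 : D) ∈ Submodule.span ℂ S)
    (hS : ∀ a, ∀ s ∈ S, a * s ∈ S) : (Submodule.span ℂ S).topologicalClosure = ⊤ := by
  refine eq_top_iff.mpr (le_trans (fun a _ => ?_) (Submodule.le_topologicalClosure _))
  have key : Submodule.span ℂ S ≤ (Submodule.span ℂ S).comap (LinearMap.mulLeft ℂ a) :=
    Submodule.span_le.mpr fun s hs => Submodule.subset_span (hS a s hs)
  simpa using key h

lemma topologicalClosure_span_eq_top' {S : Set D} (h : (1 : D) ∈ Submodule.span ℂ S)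
    (hS : ∀ a, ∀ s ∈ S, s * a ∈ S) : (Submodule.span ℂ S).topologicalClosure = ⊤ := by
  refine eq_top_iff.mpr (le_trans (fun a _ => ?_) (Submodule.le_topologicalClosure _))
  have key : Submodule.span ℂ S ≤ (Submodule.span ℂ S).comap (LinearMap.mulRight ℂ a) :=
    Submodule.span_le.mpr fun s hs => Submodule.subset_span (hS a s hs)
  simpa using key h

lemma one_mem_span : (1 : D) ∈ Submodule.span ℂ
    {a : D | ∃ x y : LinearMap.ker P.E, a = P.toBase (x * star (y : P.B))} := by
  obtain ⟨n, v, hv, -, h1⟩ := P.exists_basis_ker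
  have : (1 : D) = ∑ i, P.toBase (v i * star (v i)) := by
    apply P.inj
    simp only [map_one, map_sum, ι_toBase]
    rw [← map_sum, h1, P.E_one]
  rw [this]
  exact sum_mem fun i _ => Submodule.subset_span ⟨⟨v i, hv i⟩, ⟨v i, hv i⟩, rfl⟩

lemma star_mem_ker {b : P.B} (hb : b ∈ LinearMap.ker P.E) : star b ∈ LinearMap.ker P.E := by
  rw [LinearMap.mem_ker] at *
  rw [P.star_map, hb, star_zero]

/-- The left action of the base algebra on the kernel of the conditional expectation. -/
def kerMulLeft (a : D) : LinearMap.ker P.E →ₗ[ℂ] LinearMap.ker P.E :=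
  (LinearMap.mulLeft ℂ (P.ι a)).restrict fun x hx => by
    simp [P.bimod_l, LinearMap.mem_ker.mp hx]

/-- The right action of the base algebra on the kernel of the conditional expectation. -/
def kerMulRight (a : D) : LinearMap.ker P.E →ₗ[ℂ] LinearMap.ker P.E :=
  (LinearMap.mulRight ℂ (P.ι a)).restrict fun x hx => by
    simp [P.bimod_r, LinearMap.mem_ker.mp hx]

@[simp]
lemma coe_kerMulLeft (a : D) (x : LinearMap.ker P.E) :
    (P.kerMulLeft a x : P.B) = P.ι a * x := rfl

@[simp]
lemma coe_kerMulRight (a : D) (x : LinearMap.ker P.E) :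
    (P.kerMulRight a x : P.B) = x * P.ι a := rfl

/-- The involutive bimodule given by the kernel of the conditional expectation. -/
def kerBimod : InvBimodP D where
  X := LinearMap.ker P.E
  cplX := P.isClosed_ker.completeSpace_coe
  ls := P.kerMulLeft
  rs := P.kerMulRight
  ls_one x := Subtype.ext (by simp)
  ls_mul a b x := Subtype.ext (by simp [mul_assoc])
  ls_add a b x := Subtype.ext (by simp [add_mul])
  rs_one x := Subtype.ext (by simp)
  rs_mul a b x := Subtype.ext (by simp [mul_assoc])
  rs_add a b x := Subtype.ext (by simp [mul_add])
  ls_rs a b x := Subtype.ext (by simp [mul_assoc])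
  linn x y := P.toBase (x * star (y : P.B))
  rinn x y := P.toBase (star (x : P.B) * y)
  linn_add_left x y z := P.inj (by simp [add_mul])
  linn_smul_left c x y := P.inj (by simp)
  linn_star x y := P.inj (by simp [map_star, ← P.star_map])
  linn_ls a x y := P.inj (by simp [mul_assoc, P.bimod_l])
  rinn_add_right x y z := P.inj (by simp [mul_add])
  rinn_smul_right c x y := P.inj (by simp)
  rinn_star x y := P.inj (by simp [map_star, ← P.star_map])
  rinn_rs a x y := P.inj (by simp [← mul_assoc, P.bimod_r])
  compat x y z := Subtype.ext (by
    simp [P.E_mul_of_ker x.2 (P.star_mem_ker y.2), P.E_mul_of_ker (P.star_mem_ker y.2) z.2,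
      mul_assoc])
  lpos x := P.exists_toBase_eq (by simpa using P.E_nonneg (star (x : P.B)))
  rpos x := P.exists_toBase_eq (P.E_nonneg _)
  lfull := by
    refine topologicalClosure_span_eq_top P.one_mem_span ?_
    rintro a _ ⟨x, y, rfl⟩
    exact ⟨P.kerMulLeft a x, y, P.inj (by simp [mul_assoc, P.bimod_l])⟩
  rfull := by
    refine topologicalClosure_span_eq_top' (Submodule.span_mono ?_ P.one_mem_span) ?_
    · rintro _ ⟨x, y, rfl⟩
      exact ⟨⟨_, P.star_mem_ker x.2⟩, ⟨_, P.star_mem_ker y.2⟩, by simp⟩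
    · rintro a _ ⟨x, y, rfl⟩
      exact ⟨x, P.kerMulRight a y, P.inj (by simp [← mul_assoc, P.bimod_r])⟩
  norm_inn x := by
    rw [← NonUnitalStarAlgHom.norm_map P.ι P.inj, ι_toBase,
      P.E_mul_of_ker (P.star_mem_ker x.2) x.2, CStarRing.norm_star_mul_self, pow_two]
    rfl
  sh x := ⟨star (x : P.B), P.star_mem_ker x.2⟩
  sh_add x y := Subtype.ext (by simp)
  sh_smul c x := Subtype.ext (by simp)
  sh_sh x := Subtype.ext (by simp)
  sh_ls a x := Subtype.ext (by simp [map_star])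
  sh_rs a x := Subtype.ext (by simp [map_star])
  sh_inn x y := by simp

lemma realizes_kerBimod : Realizes P P.kerBimod :=
  ⟨(LinearMap.ker P.E).subtype, Subtype.val_injective, Subtype.range_coe,
    fun _ _ => rfl, fun _ _ => rfl, fun _ _ => P.ι_toBase _, fun _ _ => P.ι_toBase _,
    fun _ => rfl⟩

end

end IncPair

section Realizes

variable {D : Type u} [CStarAlgebra D] {P Q : IncPair D} {M N : InvBimodP D}

/-- If `M` realizes the bimodule of `P`, then the algebra of `P` is `D × M.X` with the operations
of the inclusion associated to `M`. -/
lemma Realizes.exists_linearEquiv (h : Realizes P M) : ∃ φ : (D × M.X) ≃ₗ[ℂ] P.B,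
    (∀ a, φ (a, 0) = P.ι a) ∧
    (∀ z w, φ z * φ w =
      φ (z.1 * w.1 + M.linn z.2 (M.sh w.2), M.ls z.1 w.2 + M.rs w.1 z.2)) ∧
    (∀ z, star (φ z) = φ (star z.1, M.sh z.2)) ∧
    (∀ z, P.E (φ z) = P.ι z.1) := by
  obtain ⟨θ, hinj, hrange, hl, hr, hli, -, hs⟩ := h
  have hθ (x) : P.E (θ x) = 0 := by
    have : θ x ∈ Set.range θ := ⟨x, rfl⟩
    rwa [hrange] at this
  let f : (D × M.X) →ₗ[ℂ] P.B := (P.ι.toAlgHom.toLinearMap).coprod θ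
  have hf (z) : f z = P.ι z.1 + θ z.2 := rfl
  have hE (z) : P.E (f z) = P.ι z.1 := by rw [hf, map_add, hθ, P.fixes, add_zero]
  have hbij : Function.Bijective f := by
    constructor
    · rw [← LinearMap.ker_eq_bot, LinearMap.ker_eq_bot']
      intro z hz
      have h1 : z.1 = 0 := P.inj (by rw [← hE, hz, map_zero, map_zero])
      rw [hf, h1, map_zero, zero_add] at hz
      exact Prod.ext h1 (hinj (by rw [hz]; simp))
    · intro b
      obtain ⟨a, ha⟩ := P.mem b
      have : b - P.E b ∈ Set.range θ := by
        rw [hrange]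
        simp [P.E_E]
      obtain ⟨x, hx⟩ := this
      exact ⟨(a, x), by rw [hf]; simp only [ha, hx]; abel⟩
  refine ⟨LinearEquiv.ofBijective f hbij, fun a => ?_, fun z w => ?_, fun z => ?_, hE⟩
  · simp [hf]
  · have hm : P.ι (M.linn z.2 (M.sh w.2)) = θ z.2 * θ w.2 := by
      rw [hli, hs, star_star, P.E_mul_of_ker (hθ _) (hθ _)]
    simp only [LinearEquiv.ofBijective_apply, hf, map_add, map_mul, hm, hl, hr, mul_add, add_mul]
    abel
  · simp [hf, hs, map_star]

lemma Realizes.incEquiv (hP : Realizes P M) (hQ : Realizes Q M) : IncEquiv P Q := by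
  obtain ⟨φ, h1, hm, hs, hE⟩ := hP.exists_linearEquiv
  obtain ⟨ψ, k1, km, ks, kE⟩ := hQ.exists_linearEquiv
  let e : P.B ≃ₗ[ℂ] Q.B := φ.symm.trans ψ
  have he (z) : e (φ z) = ψ z := by simp [e]
  have hι (a) : e (P.ι a) = Q.ι a := by rw [← h1, he, k1]
  refine ⟨⟨⟨⟨e.toEquiv, fun b c => ?_, e.map_add⟩, fun b => ?_⟩, e.map_smul⟩, hι, fun b => ?_⟩
  · obtain ⟨z, rfl⟩ := φ.surjective b
    obtain ⟨w, rfl⟩ := φ.surjective c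
    change e (φ z * φ w) = e (φ z) * e (φ w)
    rw [hm, he, he, he, km]
  · obtain ⟨z, rfl⟩ := φ.surjective b
    change e (star (φ z)) = star (e (φ z))
    rw [hs, he, he, ks]
  · obtain ⟨z, rfl⟩ := φ.surjective b
    change e (P.E (φ z)) = Q.E (e (φ z))
    rw [hE, hι, he, kE]

lemma Realizes.of_bimodEquiv (h : Realizes P M) (e : BimodEquiv M N) : Realizes P N := by
  obtain ⟨θ, hinj, hrange, hl, hr, hli, hri, hs⟩ := h
  obtain ⟨ρ, el, er, eli, eri, es⟩ := e
  refine ⟨θ ∘ₗ ρ.symm.toLinearMap, hinj.comp ρ.symm.injective, ?_, fun a x => ?_, fun a x => ?_,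
    fun x y => ?_, fun x y => ?_, fun x => ?_⟩
  · rw [← hrange]
    exact ρ.symm.surjective.range_comp θ
  all_goals obtain ⟨x, rfl⟩ := ρ.surjective x
  · simp [← el, hl]
  · simp [← er, hr]
  · obtain ⟨y, rfl⟩ := ρ.surjective y
    simp [eli, hli]
  · obtain ⟨y, rfl⟩ := ρ.surjective y
    simp [eri, hri]
  · simp [← es, hs]

lemma Realizes.bimodEquiv (hM : Realizes P M) (hN : Realizes P N) : BimodEquiv M N := by
  obtain ⟨θ, hinj, hrange, hl, hr, hli, hri, hs⟩ := hM
  obtain ⟨η, kinj, krange, kl, kr, kli, kri, ks⟩ := hN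
  have hR : LinearMap.range θ = LinearMap.range η :=
    SetLike.coe_injective (hrange.trans krange.symm)
  let ρ : M.X ≃ₗ[ℂ] N.X := (LinearEquiv.ofInjective θ hinj).trans
    ((LinearEquiv.ofEq _ _ hR).trans (LinearEquiv.ofInjective η kinj).symm)
  have hρ (x) : η (ρ x) = θ x := by
    have := congrArg Subtype.val (LinearEquiv.apply_symm_apply (LinearEquiv.ofInjective η kinj)
      (LinearEquiv.ofEq _ _ hR (LinearEquiv.ofInjective θ hinj x)))
    exact this
  refine ⟨ρ, fun a x => kinj ?_, fun a x => kinj ?_, fun x y => P.inj ?_, fun x y => P.inj ?_,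
    fun x => kinj ?_⟩
  · rw [hρ, hl, kl, hρ]
  · rw [hρ, hr, kr, hρ]
  · rw [kli, hli, hρ, hρ]
  · rw [kri, hri, hρ, hρ]
  · rw [hρ, hs, ks, hρ]

lemma Realizes.of_incEquiv (h : Realizes P M) (e : IncEquiv P Q) : Realizes Q M := by
  obtain ⟨θ, hinj, hrange, hl, hr, hli, hri, hs⟩ := h
  obtain ⟨π, eι, eE⟩ := e
  refine ⟨π.toAlgEquiv.toLinearMap ∘ₗ θ, (EquivLike.injective π).comp hinj, ?_,
    fun a x => ?_, fun a x => ?_, fun x y => ?_, fun x y => ?_, fun x => ?_⟩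
  · ext b
    obtain ⟨c, rfl⟩ := EquivLike.surjective π b
    have : c ∈ Set.range θ ↔ P.E c = 0 := by rw [hrange]; rfl
    have h0 : Q.E (π c) = 0 ↔ P.E c = 0 := by
      rw [← eE, map_eq_zero_iff π (EquivLike.injective π)]
    rw [Set.mem_ofPred_eq, h0, ← this]
    simp
  · simp [hl, eι]
  · simp [hr, eι]
  · simp [← eι, hli, eE, map_star]
  · simp [← eι, hri, eE, map_star]
  · simp [hs, map_star]

end Realizes

namespace InvBimodP

section

variable {D : Type u} [CStarAlgebra D] (M : InvBimodP D)

attribute [local instance] CStarAlgebra.spectralOrder CStarAlgebra.spectralOrderedRing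

lemma linn_eq_rinn_sh (x y : M.X) : M.linn x y = M.rinn (M.sh x) (M.sh y) := by
  rw [← M.sh_inn, M.sh_sh]

lemma rinn_eq_linn_sh (x y : M.X) : M.rinn x y = M.linn (M.sh x) (M.sh y) := by
  rw [M.sh_inn, M.sh_sh]

lemma linn_add_right (x y z : M.X) : M.linn x (y + z) = M.linn x y + M.linn x z := by
  rw [← M.linn_star, M.linn_add_left, star_add, M.linn_star, M.linn_star]

lemma linn_smul_right (c : ℂ) (x y : M.X) : M.linn x (c • y) = star c • M.linn x y := by
  rw [← M.linn_star, M.linn_smul_left, star_smul, M.linn_star]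

lemma linn_ls_right (a : D) (x y : M.X) : M.linn x (M.ls a y) = M.linn x y * star a := by
  rw [← M.linn_star, M.linn_ls, star_mul, M.linn_star]

lemma linn_zero_left (x : M.X) : M.linn 0 x = 0 := by
  simpa using M.linn_smul_left 0 0 x

lemma linn_zero_right (x : M.X) : M.linn x 0 = 0 := by
  simpa using M.linn_smul_right 0 x 0

lemma linn_sub_left (x y z : M.X) : M.linn (x - y) z = M.linn x z - M.linn y z := by
  rw [eq_sub_iff_add_eq, ← M.linn_add_left, sub_add_cancel]

lemma linn_sub_right (x y z : M.X) : M.linn x (y - z) = M.linn x y - M.linn x z := by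
  rw [eq_sub_iff_add_eq, ← M.linn_add_right, sub_add_cancel]

lemma linn_self_nonneg (x : M.X) : 0 ≤ M.linn x x := by
  obtain ⟨a, ha⟩ := M.lpos x
  rw [ha]
  exact star_mul_self_nonneg a

lemma sh_zero : M.sh 0 = 0 := by
  simpa using M.sh_smul 0 0

lemma norm_sh_sq (x : M.X) : ‖M.sh x‖ ^ 2 = ‖M.linn x x‖ := by
  rw [M.norm_inn, ← M.linn_eq_rinn_sh]

lemma linn_self_eq_zero {x : M.X} : M.linn x x = 0 ↔ x = 0 := by
  refine ⟨fun h => ?_, fun h => by rw [h, M.linn_zero_left]⟩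
  have h1 := M.norm_sh_sq x
  rw [h, norm_zero, sq_eq_zero_iff, norm_eq_zero] at h1
  rw [← M.sh_sh x, h1, M.sh_zero]

lemma ext_linn {x y : M.X} (h : ∀ z, M.linn x z = M.linn y z) : x = y := by
  rw [← sub_eq_zero, ← M.linn_self_eq_zero, M.linn_sub_left, h, sub_self]

lemma ls_smul (c : ℂ) (a : D) (x : M.X) : M.ls (c • a) x = c • M.ls a x :=
  M.ext_linn fun z => by rw [M.linn_ls, M.linn_smul_left, M.linn_ls, smul_mul_assoc]

lemma ls_zero (x : M.X) : M.ls 0 x = 0 := by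
  simpa using M.ls_smul 0 0 x

lemma rs_eq_sh (a : D) (x : M.X) : M.rs a x = M.sh (M.ls (star a) (M.sh x)) := by
  rw [M.sh_ls, star_star, M.sh_sh]

lemma rs_smul (c : ℂ) (a : D) (x : M.X) : M.rs (c • a) x = c • M.rs a x := by
  rw [rs_eq_sh, rs_eq_sh, star_smul, M.ls_smul, M.sh_smul, star_star]

lemma rs_zero (x : M.X) : M.rs 0 x = 0 := by
  simpa using M.rs_smul 0 0 x

/-- Fullness implies that the inner products span the whole (unital) algebra. -/
lemma span_linn_eq_top : Submodule.span ℂ {a : D | ∃ x y, a = M.linn x y} = ⊤ := by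
  set I := Submodule.span ℂ {a : D | ∃ x y, a = M.linn x y} with hI
  have hmul (a : D) : I ≤ I.comap (LinearMap.mulLeft ℂ a) := by
    refine Submodule.span_le.mpr ?_
    rintro _ ⟨x, y, rfl⟩
    exact Submodule.subset_span ⟨M.ls a x, y, (M.linn_ls a x y).symm⟩
  have h1 : (1 : D) ∈ closure (I : Set D) := by
    rw [← Submodule.topologicalClosure_coe, M.lfull]
    trivial
  obtain ⟨b, hb, hlt⟩ := Metric.mem_closure_iff.mp h1 1 one_pos
  rw [dist_eq_norm] at hlt
  have hu : IsUnit b := by simpa using isUnit_one_sub_of_norm_lt_one hlt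
  obtain ⟨c, hc⟩ := hu.exists_left_inv
  refine eq_top_iff.mpr fun a _ => ?_
  have := hmul (a * c) hb
  simpa [mul_assoc, hc] using this

lemma linn_induction {p : D → Prop} (zero : p 0) (add : ∀ a b, p a → p b → p (a + b))
    (linn : ∀ x y, p (M.linn x y)) (a : D) : p a := by
  have ha : a ∈ Submodule.span ℂ {a : D | ∃ x y, a = M.linn x y} := by
    rw [M.span_linn_eq_top]
    trivial
  induction ha using Submodule.closure_induction with
  | zero => exact zero
  | add a b _ _ ha hb => exact add a b ha hb
  | smul_mem c a ha =>
    obtain ⟨x, y, rfl⟩ := ha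
    rw [← M.linn_smul_left]
    exact linn _ _

lemma rinn_ls (a : D) (x y : M.X) : M.rinn (M.ls a x) y = M.rinn x (M.ls (star a) y) := by
  have rinn_rs_left (b : D) (x y : M.X) : M.rinn (M.rs b x) y = star b * M.rinn x y := by
    rw [← M.rinn_star, M.rinn_rs, star_mul, M.rinn_star]
  induction a using M.linn_induction with
  | zero => simp [M.ls_zero, rinn_eq_linn_sh, M.sh_zero, M.linn_zero_left, M.linn_zero_right]
  | add a b ha hb =>
    have rinn_add_left (x y z : M.X) : M.rinn (x + y) z = M.rinn x z + M.rinn y z := by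
      simp only [rinn_eq_linn_sh, M.sh_add, M.linn_add_left]
    rw [M.ls_add, rinn_add_left, star_add, M.ls_add, M.rinn_add_right, ha, hb]
  | linn p q =>
    rw [M.compat, M.linn_star, M.compat, rinn_rs_left, M.rinn_rs, M.rinn_star]

lemma linn_rs (a : D) (x y : M.X) : M.linn (M.rs a x) y = M.linn x (M.rs (star a) y) := by
  rw [linn_eq_rinn_sh, linn_eq_rinn_sh, M.sh_rs, M.sh_rs, rinn_ls]

lemma exists_sum_linn_eq_one : ∃ n, ∃ x : Fin n → M.X, ∑ i, M.linn (x i) (x i) = 1 := by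
  have key (a : D) : ∃ n, ∃ x : Fin n → M.X, a + star a ≤ ∑ i, M.linn (x i) (x i) := by
    induction a using M.linn_induction with
    | zero => exact ⟨0, Fin.elim0, by simp⟩
    | add a b ha hb =>
      obtain ⟨m, x, hx⟩ := ha
      obtain ⟨n, y, hy⟩ := hb
      refine ⟨m + n, Fin.append x y, ?_⟩
      simp only [Fin.sum_univ_add, Fin.append_left, Fin.append_right, star_add]
      calc a + b + (star a + star b) = (a + star a) + (b + star b) := by abel
        _ ≤ _ := add_le_add hx hy
    | linn x y =>
      refine ⟨2, ![x, y], ?_⟩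
      have h := M.linn_self_nonneg (x - y)
      have e : M.linn (x - y) (x - y)
          = M.linn x x + M.linn y y - (M.linn x y + star (M.linn x y)) := by
        rw [M.linn_star, M.linn_sub_left, M.linn_sub_right, M.linn_sub_right]
        abel
      rw [e, sub_nonneg] at h
      simpa [Fin.sum_univ_two] using h
  obtain ⟨n, x, hx⟩ := key 1
  set h := ∑ i, M.linn (x i) (x i) with hh
  have h1 : (1 : D) ≤ h := by
    refine le_trans ?_ hx
    rw [star_one]
    exact le_add_of_nonneg_right zero_le_one
  have hpos : IsStrictlyPositive h := IsStrictlyPositive.of_le isStrictlyPositive_one h1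
  refine ⟨n, fun i => M.ls (h ^ (-(1 / 2) : ℝ)) (x i), ?_⟩
  have hs : star (h ^ (-(1 / 2) : ℝ)) = h ^ (-(1 / 2) : ℝ) :=
    (IsSelfAdjoint.of_nonneg CFC.rpow_nonneg).star_eq
  simp only [M.linn_ls, M.linn_ls_right, hs, ← Finset.mul_sum, ← Finset.sum_mul, ← hh]
  rw [← mul_assoc]
  exact CFC.conjugate_rpow_neg_one_half h hpos

lemma norm_linn_rs_self_le (a : D) (x : M.X) :
    ‖M.linn (M.rs a x) (M.rs a x)‖ ≤ ‖a‖ ^ 2 * ‖M.linn x x‖ := by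
  have e (a : D) : M.linn (M.rs (a * star a) x) x = M.linn (M.rs a x) (M.rs a x) := by
    rw [M.rs_mul, linn_rs, star_star]
  obtain ⟨c, hc⟩ := CStarAlgebra.nonneg_iff_eq_star_mul_self.mp
    (sub_nonneg.mpr (CStarAlgebra.mul_star_le_algebraMap_norm_sq (a := a)))
  have hle : M.linn (M.rs a x) (M.rs a x) ≤ (‖a‖ ^ 2) • M.linn x x := by
    have h1 : ‖a‖ ^ 2 • M.linn x x = M.linn (M.rs (algebraMap ℝ D (‖a‖ ^ 2)) x) x := by
      rw [Algebra.algebraMap_eq_smul_one, ← Complex.coe_smul, ← Complex.coe_smul, M.rs_smul,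
        M.rs_one, M.linn_smul_left]
    have h2 : algebraMap ℝ D (‖a‖ ^ 2) = a * star a + star c * star (star c) := by
      rw [star_star, ← hc]
      abel
    rw [h1, h2, M.rs_add, M.linn_add_left, e, e]
    exact le_add_of_nonneg_right (M.linn_self_nonneg _)
  have h := CStarAlgebra.norm_le_norm_of_nonneg_of_le (M.linn_self_nonneg _) hle
  rwa [norm_smul, Real.norm_of_nonneg (by positivity)] at h

lemma norm_sh_le (x : M.X) : ‖M.sh x‖ ≤ ‖x‖ := by
  set l := M.linn x x with hl
  have hsa : star l = l := M.linn_star x x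
  have h3 : l * l * l = M.linn (M.rs (M.rinn x x) x) (M.rs (M.rinn x x) x) := by
    rw [← M.compat, M.linn_ls, M.linn_ls_right, hsa, mul_assoc]
  have h4 : ‖l‖ ^ 4 ≤ ‖M.rinn x x‖ ^ 2 * ‖l‖ ^ 2 := by
    have e2 (b : D) (hb : star b = b) : ‖b * b‖ = ‖b‖ ^ 2 := by
      nth_rewrite 1 [← hb]
      rw [CStarRing.norm_star_mul_self, pow_two]
    calc ‖l‖ ^ 4 = ‖l * l * (l * l)‖ := by
          rw [e2 (l * l) (by rw [star_mul, hsa]), e2 l hsa]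
          ring
      _ = ‖l * l * l * l‖ := by rw [← mul_assoc]
      _ ≤ ‖l * l * l‖ * ‖l‖ := norm_mul_le _ _
      _ ≤ ‖M.rinn x x‖ ^ 2 * ‖l‖ * ‖l‖ := by
          gcongr
          rw [h3]
          exact M.norm_linn_rs_self_le _ _
      _ = _ := by ring
  have h5 : ‖l‖ ≤ ‖M.rinn x x‖ := by
    by_contra! hlt
    have hpos : 0 < ‖l‖ := (norm_nonneg _).trans_lt hlt
    have : ‖M.rinn x x‖ ^ 2 * ‖l‖ ^ 2 < ‖l‖ ^ 2 * ‖l‖ ^ 2 := by gcongr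
    nlinarith
  rw [← sq_le_sq₀ (norm_nonneg _) (norm_nonneg _), M.norm_sh_sq, M.norm_inn]
  exact h5

lemma norm_sh (x : M.X) : ‖M.sh x‖ = ‖x‖ :=
  le_antisymm (M.norm_sh_le x) (by simpa [M.sh_sh] using M.norm_sh_le (M.sh x))

lemma norm_sq_eq_norm_linn (x : M.X) : ‖x‖ ^ 2 = ‖M.linn x x‖ := by
  rw [← M.norm_sh_sq, M.norm_sh]

lemma norm_ls_le (a : D) (x : M.X) : ‖M.ls a x‖ ≤ ‖a‖ * ‖x‖ := by
  rw [← sq_le_sq₀ (norm_nonneg _) (by positivity), norm_sq_eq_norm_linn, mul_pow,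
    norm_sq_eq_norm_linn, M.linn_ls, M.linn_ls_right]
  calc ‖a * (M.linn x x * star a)‖ ≤ ‖a‖ * (‖M.linn x x‖ * ‖star a‖) :=
        (norm_mul_le _ _).trans (by gcongr; exact norm_mul_le _ _)
    _ = _ := by rw [norm_star]; ring

lemma norm_rs_le (a : D) (x : M.X) : ‖M.rs a x‖ ≤ ‖a‖ * ‖x‖ := by
  simpa [rs_eq_sh, M.norm_sh] using M.norm_ls_le (star a) (M.sh x)

/-- The underlying space of the algebra associated to an involutive bimodule: the pair `(a, x)`
stands for the matrix with diagonal entries `a` and off-diagonal entries `x` and `x^♯`. -/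
def Alg (M : InvBimodP D) : Type u := D × M.X

namespace Alg

variable {M}

instance : AddCommGroup M.Alg := inferInstanceAs (AddCommGroup (D × M.X))

instance : Module ℂ M.Alg := inferInstanceAs (Module ℂ (D × M.X))

instance : Mul M.Alg :=
  ⟨fun z w => (z.1 * w.1 + M.linn z.2 (M.sh w.2), M.ls z.1 w.2 + M.rs w.1 z.2)⟩

instance : One M.Alg := ⟨((1 : D), (0 : M.X))⟩

instance : Star M.Alg := ⟨fun z => (star z.1, M.sh z.2)⟩

@[ext]
lemma ext {z w : M.Alg} (h1 : z.1 = w.1) (h2 : z.2 = w.2) : z = w := Prod.ext h1 h2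

/-- The element with diagonal entry `a` and off-diagonal entry `x`. -/
def mk (a : D) (x : M.X) : M.Alg := (a, x)

@[simp] lemma fst_mk (a : D) (x : M.X) : (mk a x).1 = a := rfl
@[simp] lemma snd_mk (a : D) (x : M.X) : (mk a x).2 = x := rfl
@[simp] lemma fst_zero : (0 : M.Alg).1 = 0 := rfl
@[simp] lemma snd_zero : (0 : M.Alg).2 = 0 := rfl
@[simp] lemma fst_one : (1 : M.Alg).1 = 1 := rfl
@[simp] lemma snd_one : (1 : M.Alg).2 = 0 := rfl
@[simp] lemma fst_add (z w : M.Alg) : (z + w).1 = z.1 + w.1 := rfl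
@[simp] lemma snd_add (z w : M.Alg) : (z + w).2 = z.2 + w.2 := rfl
@[simp] lemma fst_smul (c : ℂ) (z : M.Alg) : (c • z).1 = c • z.1 := rfl
@[simp] lemma snd_smul (c : ℂ) (z : M.Alg) : (c • z).2 = c • z.2 := rfl
@[simp] lemma fst_mul (z w : M.Alg) : (z * w).1 = z.1 * w.1 + M.linn z.2 (M.sh w.2) := rfl
@[simp] lemma snd_mul (z w : M.Alg) : (z * w).2 = M.ls z.1 w.2 + M.rs w.1 z.2 := rfl
@[simp] lemma fst_star (z : M.Alg) : (star z).1 = star z.1 := rfl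
@[simp] lemma snd_star (z : M.Alg) : (star z).2 = M.sh z.2 := rfl

protected lemma mul_assoc (u v w : M.Alg) : u * v * w = u * (v * w) := by
  ext
  · simp only [fst_mul, snd_mul, M.sh_add, M.sh_ls, M.sh_rs, M.linn_add_left, M.linn_add_right,
      M.linn_ls, M.linn_ls_right, M.linn_rs, star_star, add_mul, mul_add, mul_assoc]
    abel
  · have h : M.ls (M.linn u.2 (M.sh v.2)) w.2 = M.rs (M.linn v.2 (M.sh w.2)) u.2 := by
      rw [M.compat, M.sh_inn]
    simp only [fst_mul, snd_mul, M.ls_add, M.rs_add, M.ls_mul, M.rs_mul, map_add, h, M.ls_rs]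
    abel

instance : Ring M.Alg :=
  { (inferInstance : AddCommGroup M.Alg) with
    mul_assoc := Alg.mul_assoc
    one_mul := fun z => by ext <;> simp [M.ls_one, M.linn_zero_left]
    mul_one := fun z => by ext <;> simp [M.rs_one, M.sh_zero, M.linn_zero_right]
    zero_mul := fun z => by ext <;> simp [M.ls_zero, M.linn_zero_left]
    mul_zero := fun z => by ext <;> simp [M.rs_zero, M.sh_zero, M.linn_zero_right]
    left_distrib := fun u v w => by
      ext
      · simp only [fst_mul, fst_add, snd_add, M.sh_add, M.linn_add_right, mul_add]
        abel
      · simp only [snd_mul, fst_add, snd_add, M.rs_add, map_add]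
        abel
    right_distrib := fun u v w => by
      ext
      · simp only [fst_mul, fst_add, snd_add, M.linn_add_left, add_mul]
        abel
      · simp only [snd_mul, fst_add, snd_add, M.ls_add, map_add]
        abel }

instance : StarRing M.Alg where
  star_involutive z := by ext <;> simp [M.sh_sh]
  star_mul z w := by
    ext
    · simp [M.linn_star, M.sh_sh, linn_eq_rinn_sh M (M.sh w.2)]
    · simp [M.sh_add, M.sh_ls, M.sh_rs, add_comm]
  star_add z w := by ext <;> simp [M.sh_add]

instance : StarModule ℂ M.Alg where
  star_smul c z := by ext <;> simp [M.sh_smul]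

instance : Algebra ℂ M.Alg :=
  Algebra.ofModule
    (fun c z w => by ext <;> simp [M.linn_smul_left, M.ls_smul])
    (fun c z w => by ext <;> simp [M.sh_smul, M.linn_smul_right, M.rs_smul])

end Alg

open scoped InnerProductSpace

instance : SMul D M.X := ⟨fun a x => M.ls a x⟩

instance : CStarModule D M.X where
  inner x y := M.linn y x
  inner_add_right := M.linn_add_left _ _ _
  inner_self_nonneg := M.linn_self_nonneg _
  inner_self := M.linn_self_eq_zero
  inner_op_smul_right := M.linn_ls _ _ _
  inner_smul_right_complex := M.linn_smul_left _ _ _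
  star_inner x y := M.linn_star _ _
  norm_eq_sqrt_norm_inner_self x := by
    rw [← M.norm_sq_eq_norm_linn, Real.sqrt_sq (norm_nonneg x)]

lemma norm_linn_le (x y : M.X) : ‖M.linn x y‖ ≤ ‖x‖ * ‖y‖ := by
  rw [mul_comm]
  exact CStarModule.norm_inner_le (A := D) M.X (x := y) (y := x)

/-- The Hilbert module on which the algebra associated to `M` acts by right multiplication. -/
abbrev HilbertModule (M : InvBimodP D) : Type u := WithCStarModule D (D × M.X)

namespace Alg

variable {M}

/-- The identification of the algebra with the Hilbert module. -/
def toHilbert : M.Alg ≃ₗ[ℂ] M.HilbertModule :=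
  (WithCStarModule.linearEquiv ℂ D (D × M.X)).symm

lemma inner_toHilbert (z w : M.Alg) : ⟪toHilbert z, toHilbert w⟫_D = (w * star z).1 := by
  rw [fst_mul, snd_star, M.sh_sh]
  rfl

lemma norm_fst_le (z : M.Alg) : ‖z.1‖ ≤ ‖toHilbert z‖ :=
  (le_max_left _ _).trans (WithCStarModule.max_le_prod_norm (toHilbert z))

lemma norm_snd_le (z : M.Alg) : ‖z.2‖ ≤ ‖toHilbert z‖ :=
  (le_max_right _ _).trans (WithCStarModule.max_le_prod_norm (toHilbert z))

lemma norm_toHilbert_le (z : M.Alg) : ‖toHilbert z‖ ≤ ‖z.1‖ + ‖z.2‖ :=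
  WithCStarModule.prod_norm_le_norm_add (toHilbert z)

lemma norm_toHilbert_mul_le (z w : M.Alg) :
    ‖toHilbert (w * z)‖ ≤ 4 * ‖toHilbert z‖ * ‖toHilbert w‖ := by
  have hz1 := norm_fst_le z
  have hz2 := norm_snd_le z
  have hw1 := norm_fst_le w
  have hw2 := norm_snd_le w
  calc ‖toHilbert (w * z)‖ ≤ ‖w.1 * z.1 + M.linn w.2 (M.sh z.2)‖ + ‖M.ls w.1 z.2 + M.rs z.1 w.2‖ :=
        norm_toHilbert_le _
    _ ≤ (‖w.1‖ * ‖z.1‖ + ‖w.2‖ * ‖z.2‖) + (‖w.1‖ * ‖z.2‖ + ‖z.1‖ * ‖w.2‖) := by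
        refine add_le_add ((norm_add_le _ _).trans (add_le_add (norm_mul_le _ _) ?_))
          ((norm_add_le _ _).trans (add_le_add (M.norm_ls_le _ _) (M.norm_rs_le _ _)))
        simpa [M.norm_sh] using M.norm_linn_le w.2 (M.sh z.2)
    _ ≤ (‖toHilbert w‖ * ‖toHilbert z‖ + ‖toHilbert w‖ * ‖toHilbert z‖)
        + (‖toHilbert w‖ * ‖toHilbert z‖ + ‖toHilbert z‖ * ‖toHilbert w‖) := by gcongr
    _ = _ := by ring

/-- Right multiplication as a continuous bilinear map on the Hilbert module. -/
def mulRightCLM : M.HilbertModule →L[ℂ] M.HilbertModule →L[ℂ] M.HilbertModule :=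
  LinearMap.mkContinuous₂
    (LinearMap.mk₂ ℂ (fun z w => toHilbert (toHilbert.symm w * toHilbert.symm z))
      (fun z₁ z₂ w => by simp [mul_add]) (fun c z w => by simp)
      (fun z w₁ w₂ => by simp [add_mul]) (fun c z w => by simp))
    4 (fun z w => by simpa using norm_toHilbert_mul_le (toHilbert.symm z) (toHilbert.symm w))

lemma mulRightCLM_toHilbert (z w : M.Alg) :
    mulRightCLM (toHilbert z) (toHilbert w) = toHilbert (w * z) := by
  simp [mulRightCLM]

open MulOpposite in
/-- The representation of the algebra by right multiplication on the Hilbert module. -/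
def rep : M.Alg →ₐ[ℂ] (M.HilbertModule →L[ℂ] M.HilbertModule)ᵐᵒᵖ :=
  AlgHom.ofLinearMap
    ((opLinearEquiv ℂ).toLinearMap ∘ₗ (mulRightCLM (M := M)).toLinearMap ∘ₗ toHilbert.toLinearMap)
    (by
      apply unop_injective
      ext w
      obtain ⟨w, rfl⟩ := toHilbert.surjective w
      simp [mulRightCLM_toHilbert])
    (fun z z' => by
      apply unop_injective
      ext w
      obtain ⟨w, rfl⟩ := toHilbert.surjective w
      simp [mulRightCLM_toHilbert, mul_assoc])

lemma unop_rep_apply (z w : M.Alg) :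
    (rep z).unop (toHilbert w) = toHilbert (w * z) := mulRightCLM_toHilbert z w

lemma rep_injective : Function.Injective (rep (M := M)) := fun z z' h => by
  have := congrArg (fun T => T.unop (toHilbert 1)) h
  simpa only [unop_rep_apply, one_mul, toHilbert.injective.eq_iff] using this

instance : NormedRing M.Alg := NormedRing.induced _ _ (rep (M := M)) rep_injective

lemma norm_def (z : M.Alg) : ‖z‖ = ‖(rep z).unop‖ := rfl

instance : NormedAlgebra ℂ M.Alg := NormedAlgebra.induced ℂ _ _ (rep (M := M))

lemma isometry_mulRightCLM_toHilbert :
    Isometry fun z : M.Alg => mulRightCLM (toHilbert z) :=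
  AddMonoidHomClass.isometry_of_norm
    ((mulRightCLM (M := M)).toLinearMap ∘ₗ toHilbert.toLinearMap) fun _ => rfl

instance : CompleteSpace M.Alg := by
  rw [completeSpace_iff_isComplete_range
    (isometry_mulRightCLM_toHilbert (M := M)).isUniformInducing]
  refine IsClosed.isComplete ?_
  have : Set.range (fun z : M.Alg => mulRightCLM (toHilbert z)) = ⋂ w : M.HilbertModule,
      {T | T w = mulRightCLM (T (toHilbert 1)) w} := by
    ext T
    simp only [Set.mem_range, Set.mem_iInter, Set.mem_ofPred_eq]
    constructor
    · rintro ⟨z, rfl⟩ w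
      rw [mulRightCLM_toHilbert, one_mul]
    · intro h
      refine ⟨toHilbert.symm (T (toHilbert 1)), ?_⟩
      ext1 w
      simpa only [LinearEquiv.apply_symm_apply] using (h w).symm
  rw [this]
  refine isClosed_iInter fun w => isClosed_eq ?_ ?_
  · exact continuous_id.clm_apply continuous_const
  · exact ((mulRightCLM (M := M)).continuous.comp
      (continuous_id.clm_apply continuous_const)).clm_apply continuous_const

instance : CStarRing M.Alg := by
  refine CStarRing.of_le_norm_mul_star_self fun z => ?_
  have h : ‖z‖ ≤ √‖z * star z‖ := by
    rw [norm_def]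
    refine ContinuousLinearMap.opNorm_le_bound _ (Real.sqrt_nonneg _) fun w => ?_
    obtain ⟨w, rfl⟩ := toHilbert.surjective w
    rw [unop_rep_apply, ← sq_le_sq₀ (norm_nonneg _) (by positivity), mul_pow,
      Real.sq_sqrt (norm_nonneg _), CStarModule.norm_sq_eq (A := D)]
    have e : ⟪toHilbert (w * z), toHilbert (w * z)⟫_D
        = ⟪toHilbert w, toHilbert (w * (z * star z))⟫_D := by
      simp only [inner_toHilbert, star_mul, mul_assoc]
    rw [e]
    calc _ ≤ ‖toHilbert w‖ * ‖toHilbert (w * (z * star z))‖ :=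
          CStarModule.norm_inner_le (A := D) M.HilbertModule
      _ ≤ ‖toHilbert w‖ * (‖z * star z‖ * ‖toHilbert w‖) := by
          gcongr
          rw [← unop_rep_apply, norm_def]
          exact ContinuousLinearMap.le_opNorm _ _
      _ = _ := by ring
  calc ‖z‖ * ‖z‖ ≤ √‖z * star z‖ * √‖z * star z‖ := by gcongr
    _ = _ := Real.mul_self_sqrt (norm_nonneg _)

/-- The embedding of the base algebra as the diagonal. -/
def incl : D →⋆ₐ[ℂ] M.Alg where
  toFun a := mk a 0
  map_one' := rfl
  map_zero' := rfl
  map_add' a b := by ext <;> simp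
  map_mul' a b := by ext <;> simp [M.linn_zero_left]
  commutes' c := by
    rw [Algebra.algebraMap_eq_smul_one, Algebra.algebraMap_eq_smul_one]
    ext <;> simp
  map_star' a := by ext <;> simp [M.sh_zero]

@[simp] lemma fst_incl (a : D) : (incl a : M.Alg).1 = a := rfl
@[simp] lemma snd_incl (a : D) : (incl a : M.Alg).2 = 0 := rfl

/-- The embedding of the bimodule as the off-diagonal. -/
def offDiag : M.X →ₗ[ℂ] M.Alg := LinearMap.inr ℂ D M.X

@[simp] lemma fst_offDiag (x : M.X) : (offDiag x : M.Alg).1 = 0 := rfl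
@[simp] lemma snd_offDiag (x : M.X) : (offDiag x : M.Alg).2 = x := rfl

/-- The conditional expectation onto the diagonal. -/
def expect : M.Alg →ₗ[ℂ] M.Alg := incl.toAlgHom.toLinearMap ∘ₗ LinearMap.fst ℂ D M.X

lemma expect_apply (z : M.Alg) : expect z = incl z.1 := rfl

@[simp] lemma fst_expect (z : M.Alg) : (expect z).1 = z.1 := rfl
@[simp] lemma snd_expect (z : M.Alg) : (expect z).2 = 0 := rfl

lemma offDiag_ls (a : D) (x : M.X) : offDiag (M.ls a x) = incl a * offDiag x := by
  ext <;> simp [M.linn_zero_left]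

lemma offDiag_rs (a : D) (x : M.X) : offDiag (M.rs a x) = offDiag x * incl a := by
  ext <;> simp [M.sh_zero, M.linn_zero_right]

lemma exists_expect_eq (z : M.Alg) : ∃ c, expect (star z * z) = star c * c := by
  have : 0 ≤ (star z * z).1 := by
    rw [fst_mul, snd_star, fst_star]
    exact add_nonneg (star_mul_self_nonneg _) (M.linn_self_nonneg _)
  obtain ⟨c, hc⟩ := CStarAlgebra.nonneg_iff_eq_star_mul_self.mp this
  exact ⟨incl c, by rw [expect_apply, hc, map_mul, map_star]⟩

lemma expect_star (z : M.Alg) : expect (star z) = star (expect z) := by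
  rw [expect_apply, expect_apply, ← map_star, fst_star]

lemma exists_quasiBasis : ∃ n, ∃ x : Fin n → M.Alg,
    (∀ b, ∑ i, x i * expect (star (x i) * b) = b) ∧
    (∀ b, ∑ i, expect (b * x i) * star (x i) = b) ∧
    (∑ i, x i * star (x i)) = 2 := by
  obtain ⟨n, x, hx⟩ := M.exists_sum_linn_eq_one
  let u : Fin (n + 1) → M.Alg := Fin.cons 1 fun i => offDiag (x i)
  have h1 (b : M.Alg) : ∑ i, u i * expect (star (u i) * b) = b := by
    have e (i) : offDiag (x i) * expect (star (offDiag (x i)) * b)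
        = offDiag (M.ls (M.linn (x i) (x i)) b.2) := by
      ext
      · simp [M.sh_zero, M.linn_zero_right]
      · simp [M.compat, M.rinn_eq_linn_sh, M.ls_zero]
    have hs : ∑ i, M.ls (M.linn (x i) (x i)) b.2 = b.2 := by
      let f : D →+ M.X := ⟨⟨fun a => M.ls a b.2, M.ls_zero _⟩, fun a a' => M.ls_add a a' _⟩
      calc ∑ i, f (M.linn (x i) (x i)) = f 1 := by rw [← map_sum, hx]
        _ = b.2 := M.ls_one _
    simp only [u, Fin.sum_univ_succ, Fin.cons_zero, Fin.cons_succ, e, ← map_sum, hs]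
    ext <;> simp
  refine ⟨n + 1, u, h1, fun b => ?_, ?_⟩
  · have := congrArg star (h1 (star b))
    simpa [← expect_star] using this
  · have e (i) : offDiag (x i) * star (offDiag (x i)) = incl (M.linn (x i) (x i)) := by
      ext <;> simp [M.sh_sh, M.ls_zero, M.rs_zero]
    simp only [u, Fin.sum_univ_succ, Fin.cons_zero, Fin.cons_succ, e, ← map_sum, hx]
    rw [star_one, one_mul, map_one]
    norm_num

end Alg

/-- The inclusion of index two associated to an involutive bimodule. -/
def incPair : IncPair D where
  B := M.Alg
  ι := Alg.incl
  inj a b h := congrArg Prod.fst h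
  E := Alg.expect
  mem b := ⟨b.1, rfl⟩
  fixes _ := rfl
  bimod_l a b := by ext <;> simp [M.linn_zero_left]
  bimod_r a b := by ext <;> simp [M.sh_zero, M.linn_zero_right]
  star_map := Alg.expect_star
  pos := Alg.exists_expect_eq
  index_two := Alg.exists_quasiBasis

lemma realizes_incPair : Realizes M.incPair M := by
  refine ⟨Alg.offDiag, fun x y h => congrArg Prod.snd h, ?_, Alg.offDiag_ls, Alg.offDiag_rs,
    fun x y => ?_, fun x y => ?_, fun x => ?_⟩
  · ext b
    refine ⟨?_, fun h => ⟨b.2, Alg.ext (congrArg Prod.fst h).symm rfl⟩⟩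
    rintro ⟨x, rfl⟩
    rfl
  · change Alg.incl _ = Alg.expect (Alg.offDiag x * star (Alg.offDiag y))
    ext <;> simp [M.sh_sh]
  · change Alg.incl _ = Alg.expect (star (Alg.offDiag x) * Alg.offDiag y)
    ext <;> simp [M.rinn_eq_linn_sh]
  · change Alg.offDiag _ = star (Alg.offDiag x)
    ext <;> simp

end

end InvBimodP

/-- the assignments `[B,E] ↦ [X_B]` and `[X] ↦ [B_X, E_X]` are mutually
inverse bijections between `ℒ/∼` and `ℳ/∼`.  (Here `F P` is characterized, following
the paper's Lemma 3.3.2, by `F P ≅ B₋ ≅ X_B`, and `G M` by the fact that `M` realizes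
the bimodule of the inclusion `G M`, which characterizes `(B_X, E_X)` up to `∼`.) -/
theorem inclusions_biject_with_involutive_bimodules :
    ∃ (F : IncPair A → InvBimodP A) (G : InvBimodP A → IncPair A),
      -- F is the map (B,E) ↦ X_B, up to ∼
      (∀ P : IncPair A, Realizes P (F P)) ∧
      -- G is the map X ↦ (B_X, E_X), up to ∼
      (∀ M : InvBimodP A, Realizes (G M) M) ∧
      -- both maps are well defined on equivalence classes
      (∀ P Q : IncPair A, IncEquiv P Q → BimodEquiv (F P) (F Q)) ∧
      (∀ M N : InvBimodP A, BimodEquiv M N → IncEquiv (G M) (G N)) ∧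
      -- and they are mutually inverse modulo ∼
      (∀ P : IncPair A, IncEquiv (G (F P)) P) ∧
      (∀ M : InvBimodP A, BimodEquiv (F (G M)) M) := by
  let _ : CStarAlgebra A := {}
  exact ⟨fun P => P.kerBimod, fun M => M.incPair,
    fun P => P.realizes_kerBimod, fun M => M.realizes_incPair,
    fun P Q h => (P.realizes_kerBimod.of_incEquiv h).bimodEquiv Q.realizes_kerBimod,
    fun M N h => (M.realizes_incPair.of_bimodEquiv h).incEquiv N.realizes_incPair,
    fun P => P.kerBimod.realizes_incPair.incEquiv P.realizes_kerBimod,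
    fun M => M.incPair.realizes_kerBimod.bimodEquiv M.realizes_incPair⟩

end
end
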